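/- Every 4-edge-connected graph G has a spanning Eulerian subgraph H (a connected spanning subgraph in which every vertex has even degree) such that for each vertex v, ⌊d_G(v)/2⌋ − 1 ≤ d_H(v) ≤ ⌈d_G(v)/2⌉ + 2. -/

import Mathlib

open Finset

variable {V E : Type*}

/-- Degree of vertex `v` in the multigraph whose edge set is `S`
(the ambient multigraph is given by the endpoint map `ends`); a loop counts twice. -/
def mdeg [DecidableEq V] (ends : E → V × V) (S : Finset E) (v : V) : ℕ :=
  ∑ e ∈ S, ((if (ends e).1 = v then 1 else 0) + (if (ends e).2 = v then 1 else 0))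

/-- The multigraph with edge set `S` is connected: all vertices are mutually reachable. -/
def MConnected (ends : E → V × V) (S : Finset E) : Prop :=
  ∀ u v : V, Relation.ReflTransGen
    (fun a b => ∃ e ∈ S, ends e = (a, b) ∨ ends e = (b, a)) u v

/-- `T` is (the edge set of) a spanning tree: connected and with `|V| - 1` edges. -/
def IsSpanningTree [Fintype V] (ends : E → V × V) (T : Finset E) : Prop :=
  MConnected ends T ∧ T.card + 1 = Fintype.card V

/-- `S` is `m`-tree-connected: it contains `m` pairwise edge-disjoint spanning trees. -/
def TreeConnected [Fintype V] (ends : E → V × V) (m : ℕ) (S : Finset E) : Prop :=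
  ∃ T : Fin m → Finset E, (∀ i, T i ⊆ S ∧ IsSpanningTree ends (T i)) ∧
    ∀ i j, i ≠ j → Disjoint (T i) (T j)

/-- The edges of `S` crossing the cut `(A, Aᶜ)`. -/
def cutEdges [DecidableEq V] (ends : E → V × V) (S : Finset E) (A : Finset V) : Finset E :=
  S.filter fun e => ¬(((ends e).1 ∈ A) ↔ ((ends e).2 ∈ A))

/-- `S` is `m`-edge-connected: every edge cut has at least `m` edges. -/
def EdgeConnected [Fintype V] [DecidableEq V] (ends : E → V × V) (m : ℕ) (S : Finset E) : Prop :=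
  ∀ A : Finset V, A.Nonempty → A ≠ Finset.univ → m ≤ (cutEdges ends S A).card

/-- Tail of the edge `e` under the orientation `σ`. -/
def otail (ends : E → V × V) (σ : E → Bool) (e : E) : V :=
  if σ e then (ends e).1 else (ends e).2

/-- Head of the edge `e` under the orientation `σ`. -/
def ohead (ends : E → V × V) (σ : E → Bool) (e : E) : V :=
  if σ e then (ends e).2 else (ends e).1

/-- Out-degree of `v` in the edge set `S` under the orientation `σ`. -/
def outDeg [DecidableEq V] (ends : E → V × V) (σ : E → Bool) (S : Finset E) (v : V) : ℕ :=
  (S.filter fun e => otail ends σ e = v).card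

/-- In-degree of `v` in the edge set `S` under the orientation `σ`. -/
def inDeg [DecidableEq V] (ends : E → V × V) (σ : E → Bool) (S : Finset E) (v : V) : ℕ :=
  (S.filter fun e => ohead ends σ e = v).card

/-- Out-degree in a directed graph, where `ends` itself records the orientation
(first component = tail, second component = head). -/
def outDegD [DecidableEq V] (ends : E → V × V) (S : Finset E) (v : V) : ℕ :=
  (S.filter fun e => (ends e).1 = v).card

/-- In-degree in a directed graph. -/
def inDegD [DecidableEq V] (ends : E → V × V) (S : Finset E) (v : V) : ℕ :=
  (S.filter fun e => (ends e).2 = v).card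

/-- `S` is `(m, l)`-partition-connected: it decomposes into an `m`-tree-connected factor
and a factor admitting an orientation in which every vertex `v` has out-degree at least `l v`. -/
def PartitionConnected [Fintype V] [DecidableEq V] [DecidableEq E]
    (ends : E → V × V) (m : ℕ) (l : V → ℤ) (S : Finset E) : Prop :=
  ∃ S₁ ⊆ S, TreeConnected ends m S₁ ∧
    ∃ σ : E → Bool, ∀ v, l v ≤ (outDeg ends σ (S \ S₁) v : ℤ)

/-- Number of edges of `S` with both ends in `A`. -/
def eIn [DecidableEq V] (ends : E → V × V) (S : Finset E) (A : Finset V) : ℕ :=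
  (S.filter fun e => (ends e).1 ∈ A ∧ (ends e).2 ∈ A).card

/-- Number of edges of `S` with one end in `A` and the other end in `B`. -/
def eBetween [DecidableEq V] (ends : E → V × V) (S : Finset E) (A B : Finset V) : ℕ :=
  (S.filter fun e =>
    ((ends e).1 ∈ A ∧ (ends e).2 ∈ B) ∨ ((ends e).1 ∈ B ∧ (ends e).2 ∈ A)).card

/-- Every edge of `S` crosses the bipartition `(X, Xᶜ)`. -/
def BipartiteWrt [DecidableEq V] (ends : E → V × V) (S : Finset E) (X : Finset V) : Prop :=
  ∀ e ∈ S, ¬(((ends e).1 ∈ X) ↔ ((ends e).2 ∈ X))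

/-- The multigraph with edge set `S` is bipartite. -/
def IsBipartiteG [DecidableEq V] (ends : E → V × V) (S : Finset E) : Prop :=
  ∃ X : Finset V, BipartiteWrt ends S X

/-- Bipartite index: the smallest number of edges whose deletion from `S`
leaves a bipartite factor. -/
noncomputable def biIndex [DecidableEq V] [DecidableEq E]
    (ends : E → V × V) (S : Finset E) : ℕ :=
  sInf {n | ∃ H ⊆ S, IsBipartiteG ends H ∧ n = (S \ H).card}

/-- `f : V → ZMod k` is compatible with the multigraph `S` with respect to the
bipartition `(X, Xᶜ)`. -/
def CompatibleWrt [Fintype V] [DecidableEq V] (ends : E → V × V) (S : Finset E)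
    {k : ℕ} (f : V → ZMod k) (X : Finset V) : Prop :=
  (∃ x : ℕ, x ≤ eIn ends S X ∧
    (∑ v ∈ X, f v) - 2 * (x : ZMod k) = ∑ v ∈ Xᶜ, f v) ∨
  (∃ y : ℕ, y ≤ eIn ends S Xᶜ ∧
    (∑ v ∈ X, f v) = (∑ v ∈ Xᶜ, f v) - 2 * (y : ZMod k))

/-- `f : V → ZMod k` is compatible with `S`: compatible with respect to every bipartition. -/
def Compatible [Fintype V] [DecidableEq V] (ends : E → V × V) (S : Finset E)
    {k : ℕ} (f : V → ZMod k) : Prop :=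
  ∀ X : Finset V, CompatibleWrt ends S f X

/-- Number of edges touching `Y`. -/
def touchE [Fintype E] [DecidableEq V] (ends : E → V × V) (Y : Finset V) : ℕ :=
  ((Finset.univ : Finset E).filter fun e => (ends e).1 ∈ Y ∨ (ends e).2 ∈ Y).card

lemma sum_mdeg_eq [Fintype E] [DecidableEq V] (ends : E → V × V) (X : Finset V) :
    ∑ v ∈ X, mdeg ends (Finset.univ : Finset E) v = eIn ends Finset.univ X + touchE ends X := by
  unfold mdeg eIn touchE
  rw [Finset.sum_comm, Finset.card_filter, Finset.card_filter, ← Finset.sum_add_distrib]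
  refine Finset.sum_congr rfl fun e _ => ?_
  rw [Finset.sum_add_distrib, Finset.sum_ite_eq, Finset.sum_ite_eq]
  by_cases h1 : (ends e).1 ∈ X <;> by_cases h2 : (ends e).2 ∈ X <;> simp [h1, h2]

lemma eIn_super [Fintype E] [DecidableEq V] (ends : E → V × V) (X Y : Finset V) :
    eIn ends (Finset.univ : Finset E) X + eIn ends (Finset.univ : Finset E) Y ≤
      eIn ends (Finset.univ : Finset E) (X ∪ Y) + eIn ends (Finset.univ : Finset E) (X ∩ Y) := by
  unfold eIn
  simp only [Finset.card_filter, ← Finset.sum_add_distrib]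
  refine Finset.sum_le_sum fun e _ => ?_
  by_cases h1 : (ends e).1 ∈ X <;> by_cases h2 : (ends e).2 ∈ X <;>
  by_cases h3 : (ends e).1 ∈ Y <;> by_cases h4 : (ends e).2 ∈ Y <;> simp [h1, h2, h3, h4]

lemma touch_sdiff [Fintype E] [DecidableEq V] (ends : E → V × V) (X Y : Finset V) :
    touchE ends (Y \ X) + eIn ends (Finset.univ : Finset E) X ≤
      touchE ends Y + eIn ends (Finset.univ : Finset E) (X \ Y) := by
  unfold eIn touchE
  simp only [Finset.card_filter, ← Finset.sum_add_distrib]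
  refine Finset.sum_le_sum fun e _ => ?_
  by_cases h1 : (ends e).1 ∈ X <;> by_cases h2 : (ends e).2 ∈ X <;>
  by_cases h3 : (ends e).1 ∈ Y <;> by_cases h4 : (ends e).2 ∈ Y <;> simp [h1, h2, h3, h4]

lemma eIn_le_touch [Fintype E] [DecidableEq V] (ends : E → V × V) (X : Finset V) :
    eIn ends (Finset.univ : Finset E) X ≤ touchE ends X := by
  unfold eIn touchE
  refine Finset.card_le_card fun e => ?_
  simp only [Finset.mem_filter]; tauto

lemma eIn_cut [Fintype E] [DecidableEq V] (ends : E → V × V) (X : Finset V) :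
    eIn ends (Finset.univ : Finset E) X + (cutEdges ends Finset.univ X).card = touchE ends X := by
  unfold eIn touchE cutEdges
  simp only [Finset.card_filter, ← Finset.sum_add_distrib]
  refine Finset.sum_congr rfl fun e _ => ?_
  by_cases h1 : (ends e).1 ∈ X <;> by_cases h2 : (ends e).2 ∈ X <;> simp [h1, h2]

/-- The in-degree vector. -/
lemma exists_m [Fintype V] [DecidableEq V] [Fintype E]
    (ends : E → V × V) (hG : EdgeConnected ends 4 (Finset.univ : Finset E)) (r : V) :
    ∃ m : V → ℕ, (∀ v, mdeg ends (Finset.univ : Finset E) v / 2 ≤ m v) ∧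
      (∀ X : Finset V, X.Nonempty → r ∉ X →
        eIn ends (Finset.univ : Finset E) X + 2 ≤ ∑ v ∈ X, m v) ∧
      ∀ Y : Finset V, ∑ v ∈ Y, m v ≤ touchE ends Y := by
  have hcut : ∀ X : Finset V, X.Nonempty → r ∉ X →
      eIn ends (Finset.univ : Finset E) X + 4 ≤ touchE ends X := by
    intro X hX hr
    have h1 := hG X hX (by rintro rfl; simp at hr)
    have h2 := eIn_cut ends X
    omega
  let P : (V → ℕ) → Prop := fun m =>
    (∀ v, mdeg ends (Finset.univ : Finset E) v / 2 ≤ m v) ∧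
      (∀ X : Finset V, X.Nonempty → r ∉ X →
        eIn ends (Finset.univ : Finset E) X + 2 ≤ ∑ v ∈ X, m v)
  have hex : ∃ n, ∃ m, P m ∧ ∑ v, m v = n := by
    refine ⟨_, fun v => mdeg ends (Finset.univ : Finset E) v,
      ⟨fun v => Nat.div_le_self _ _, fun X hX hr => ?_⟩, rfl⟩
    have := hcut X hX hr
    rw [sum_mdeg_eq]; omega
  classical
  obtain ⟨m, hm, hsum⟩ := Nat.find_spec hex
  have hmin : ∀ m', P m' → ∑ v, m v ≤ ∑ v, m' v := by
    intro m' hm'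
    rw [hsum]
    exact Nat.find_min' hex ⟨m', hm', rfl⟩
  let Tight : Finset V → Prop := fun X => X.Nonempty ∧ r ∉ X ∧
    ∑ v ∈ X, m v = eIn ends (Finset.univ : Finset E) X + 2
  have hloose : ∀ v, mdeg ends (Finset.univ : Finset E) v / 2 < m v →
      ∃ X, Tight X ∧ v ∈ X := by
    intro v hv
    by_contra hcon
    push Not at hcon
    have hP : P (Function.update m v (m v - 1)) := by
      refine ⟨fun w => ?_, fun X hX hr => ?_⟩
      · by_cases hw : w = v
        · subst hw; simp; omega
        · simp [hw]; exact hm.1 w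
      · by_cases hvX : v ∈ X
        · have h1 := hm.2 X hX hr
          have h2 : ∑ v ∈ X, m v ≠ eIn ends (Finset.univ : Finset E) X + 2 :=
            fun h => hcon X ⟨hX, hr, h⟩ hvX
          rw [Finset.sum_update_of_mem hvX]
          have h3 := Finset.sum_sdiff (f := m) (Finset.singleton_subset_iff.2 hvX)
          simp only [Finset.sum_singleton] at h3
          omega
        · rw [Finset.sum_update_of_notMem hvX]; exact hm.2 X hX hr
    have h4 := hmin _ hP
    rw [Finset.sum_update_of_mem (Finset.mem_univ v)] at h4
    have h3 := Finset.sum_sdiff (f := m) (Finset.subset_univ {v})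
    simp only [Finset.sum_singleton] at h3
    omega
  have hunion : ∀ X X', Tight X → Tight X' → (X ∩ X').Nonempty → Tight (X ∪ X') := by
    intro X X' hX hX' hne
    have hr : r ∉ X ∪ X' := by simp [hX.2.1, hX'.2.1]
    have hr' : r ∉ X ∩ X' := by simp [hX.2.1]
    refine ⟨hX.1.mono Finset.subset_union_left, hr, ?_⟩
    have h1 := hm.2 _ (hX.1.mono (Finset.subset_union_left (s₂ := X'))) hr
    have h2 := hm.2 _ hne hr'
    have h3 := eIn_super ends X X'
    have h4 := Finset.sum_union_inter (f := m) (s₁ := X) (s₂ := X')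
    have h5 := hX.2.2
    have h6 := hX'.2.2
    omega
  have hclosed : ∀ n, ∀ Z : Finset V, Z.card ≤ n → (∀ X, Tight X → (X ∩ Z).Nonempty → X ⊆ Z) →
      2 * ∑ v ∈ Z, m v ≤ ∑ v ∈ Z, mdeg ends (Finset.univ : Finset E) v := by
    intro n
    induction n with
    | zero =>
      intro Z hZ _
      have : Z = ∅ := by simpa using hZ
      subst this; simp
    | succ n ih =>
      intro Z hZ hcl
      rcases Z.eq_empty_or_nonempty with rfl | ⟨v, hv⟩
      · simp
      by_cases hT : ∃ X, Tight X ∧ v ∈ X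
      · obtain ⟨X0, hX0, hvX0⟩ := hT
        obtain ⟨X, hX, hmax⟩ := Finset.exists_max_image
          ((Finset.univ : Finset (Finset V)).filter fun X => Tight X ∧ v ∈ X) Finset.card
          ⟨X0, by simp [hX0, hvX0]⟩
        simp only [Finset.mem_filter, Finset.mem_univ, true_and] at hX hmax
        have hXZ : X ⊆ Z := hcl X hX.1 ⟨v, by simp [hX.2, hv]⟩
        have h1 := ih (Z \ X) (by
          have h1 := Finset.card_sdiff_add_card_eq_card hXZ
          have h2 := Finset.card_pos.2 hX.1.1
          omega) (by
          intro X' hX' hne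
          have h2 : X' ⊆ Z := hcl X' hX' (by
            obtain ⟨w, hw⟩ := hne
            exact ⟨w, by simp at hw ⊢; tauto⟩)
          have h3 : ¬ (X ∩ X').Nonempty := by
            intro h3
            have h4 := hmax _ ⟨hunion _ _ hX.1 hX' h3, by simp [hX.2]⟩
            have h5 := Finset.eq_of_subset_of_card_le Finset.subset_union_left h4
            obtain ⟨w, hw⟩ := hne
            have : w ∈ X := by
              rw [h5]; simp at hw ⊢; tauto
            simp at hw; tauto
          intro w hw
          refine Finset.mem_sdiff.2 ⟨h2 hw, fun hwX => h3 ⟨w, by simp [hw, hwX]⟩⟩)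
        have h2 := Finset.sum_sdiff (f := m) hXZ
        have h3 := Finset.sum_sdiff (f := fun v => mdeg ends (Finset.univ : Finset E) v) hXZ
        have h4 := hcut X hX.1.1 hX.1.2.1
        have h5 := sum_mdeg_eq ends X
        have h6 := hX.1.2.2
        omega
      · have hmv : m v = mdeg ends (Finset.univ : Finset E) v / 2 := by
          by_contra hne
          exact hT (hloose v (lt_of_le_of_ne (hm.1 v) (Ne.symm hne)))
        have h1 := ih (Z.erase v) (by rw [Finset.card_erase_of_mem hv]; omega) (by
          intro X hX hne w hw
          refine Finset.mem_erase.2 ⟨?_, hcl X hX ?_ hw⟩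
          · rintro rfl; exact hT ⟨X, hX, hw⟩
          · obtain ⟨u, hu⟩ := hne
            exact ⟨u, by simp at hu ⊢; tauto⟩)
        have h2 := Finset.add_sum_erase _ m hv
        have h3 := Finset.add_sum_erase _ (fun v => mdeg ends (Finset.univ : Finset E) v) hv
        omega
  refine ⟨m, hm.1, hm.2, ?_⟩
  have key : ∀ n, ∀ Y : Finset V, Y.card ≤ n → ∑ v ∈ Y, m v ≤ touchE ends Y := by
    intro n
    induction n with
    | zero =>
      intro Z hZ
      have : Z = ∅ := by simpa using hZ
      subst this; simp
    | succ n ih =>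
      intro Y hY
      by_cases hcl : ∀ X, Tight X → (X ∩ Y).Nonempty → X ⊆ Y
      · have h1 := hclosed _ Y le_rfl hcl
        have h2 := sum_mdeg_eq ends Y
        have h3 := eIn_le_touch ends Y
        omega
      · push Not at hcl
        obtain ⟨X, hX, hne, hXY⟩ := hcl
        have hne2 : (X \ Y).Nonempty := Finset.sdiff_nonempty.2 hXY
        have h1 := ih (Y \ X) (by
          have h1 := Finset.card_sdiff_add_card_inter Y X
          rw [Finset.inter_comm] at h1
          have h2 := Finset.card_pos.2 hne
          omega)
        have h2 := touch_sdiff ends X Y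
        have h3 := hm.2 (X \ Y) hne2 (by simp [hX.2.1])
        have h4 := Finset.sum_inter_add_sum_sdiff Y X m
        have h5 := Finset.sum_inter_add_sum_sdiff X Y m
        rw [Finset.inter_comm] at h5
        have h6 := hX.2.2
        omega
  exact fun Y => key _ Y le_rfl

/-- Number of elements of `S` sent to `v` by `f`. -/
def cntAt [DecidableEq V] (f : E → V) (S : Finset E) (v : V) : ℕ :=
  (S.filter fun e => f e = v).card

/-- Number of arcs of `S` entering `X`. -/
def rhoD [DecidableEq V] (tl hd : E → V) (S : Finset E) (X : Finset V) : ℕ :=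
  (S.filter fun e => hd e ∈ X ∧ tl e ∉ X).card

lemma sum_cntAt [DecidableEq V] (f : E → V) (S : Finset E) (X : Finset V) :
    ∑ v ∈ X, cntAt f S v = (S.filter fun e => f e ∈ X).card := by
  unfold cntAt
  simp only [Finset.card_filter]
  rw [Finset.sum_comm]
  refine Finset.sum_congr rfl fun e _ => ?_
  rw [Finset.sum_ite_eq]

lemma exists_orientation [Fintype V] [DecidableEq V] [Fintype E] [DecidableEq E]
    (ends : E → V × V) (hG : EdgeConnected ends 4 (Finset.univ : Finset E)) (r : V) :
    ∃ tl hd : E → V, (∀ e, ends e = (tl e, hd e) ∨ ends e = (hd e, tl e)) ∧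
      (∀ v, mdeg ends (Finset.univ : Finset E) v / 2 ≤ cntAt hd Finset.univ v) ∧
      ∀ X : Finset V, X.Nonempty → r ∉ X → 2 ≤ rhoD tl hd Finset.univ X := by
  classical
  obtain ⟨m, hm1, hm2, hm3⟩ := exists_m ends hG r
  let t : (Σ v : V, Fin (m v)) → Finset E := fun s =>
    Finset.univ.filter fun e => (ends e).1 = s.1 ∨ (ends e).2 = s.1
  have hall : ∀ s : Finset (Σ v : V, Fin (m v)), s.card ≤ (s.biUnion t).card := by
    intro s
    have h1 : s ⊆ (s.image Sigma.fst).sigma fun v => (Finset.univ : Finset (Fin (m v))) := by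
      intro x hx
      simp only [Finset.mem_sigma, Finset.mem_univ, and_true]
      exact Finset.mem_image_of_mem _ hx
    have h2 := Finset.card_le_card h1
    rw [Finset.card_sigma] at h2
    simp only [Finset.card_univ, Fintype.card_fin] at h2
    refine h2.trans ((hm3 _).trans (Finset.card_le_card ?_))
    intro e he
    simp only [Finset.mem_filter, Finset.mem_univ, true_and, Finset.mem_image] at he
    simp only [Finset.mem_biUnion, t, Finset.mem_filter, Finset.mem_univ, true_and]
    rcases he with ⟨a, ha, h⟩ | ⟨a, ha, h⟩
    · exact ⟨a, ha, Or.inl h.symm⟩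
    · exact ⟨a, ha, Or.inr h.symm⟩
  obtain ⟨f, hf, hft⟩ := (Finset.all_card_le_biUnion_card_iff_exists_injective t).1 hall
  have hft' : ∀ s, (ends (f s)).1 = s.1 ∨ (ends (f s)).2 = s.1 := by
    intro s; have := hft s; simpa [t] using this
  let hd : E → V := fun e => if h : ∃ s, f s = e then h.choose.1 else (ends e).2
  have hhd : ∀ s, hd (f s) = s.1 := by
    intro s
    have h : ∃ s', f s' = f s := ⟨s, rfl⟩
    have h2 : h.choose = s := hf h.choose_spec
    simp only [hd, dif_pos h, h2]
  have hends : ∀ e, (ends e).1 = hd e ∨ (ends e).2 = hd e := by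
    intro e
    by_cases h : ∃ s, f s = e
    · obtain ⟨s, rfl⟩ := h
      rw [hhd]; exact hft' s
    · right; simp only [hd, dif_neg h]
  let tl : E → V := fun e => if (ends e).1 = hd e then (ends e).2 else (ends e).1
  have hor : ∀ e, ends e = (tl e, hd e) ∨ ends e = (hd e, tl e) := by
    intro e
    by_cases h : (ends e).1 = hd e
    · right; simp only [tl, if_pos h]; rw [← h]
    · left; simp only [tl, if_neg h]
      have := (hends e).resolve_left h
      rw [← this]
  have hin : ∀ v, m v ≤ cntAt hd Finset.univ v := by
    intro v
    have h1 : ((Finset.univ : Finset (Fin (m v))).image fun i => f ⟨v, i⟩) ⊆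
        (Finset.univ : Finset E).filter fun e => hd e = v := by
      intro e he
      simp only [Finset.mem_image, Finset.mem_univ, true_and] at he
      obtain ⟨i, rfl⟩ := he
      simp [hhd]
    have h2 := Finset.card_le_card h1
    rw [Finset.card_image_of_injective] at h2
    · simpa [cntAt] using h2
    · intro i j hij
      have := hf hij
      simpa using this
  refine ⟨tl, hd, hor, fun v => (hm1 v).trans (hin v), fun X hX hr => ?_⟩
  have h1 := hm2 X hX hr
  have h2 : ∑ v ∈ X, m v ≤ ∑ v ∈ X, cntAt hd Finset.univ v :=
    Finset.sum_le_sum fun v _ => hin v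
  rw [sum_cntAt] at h2
  have h3 : (Finset.univ.filter fun e => hd e ∈ X).card =
      rhoD tl hd Finset.univ X + eIn ends Finset.univ X := by
    unfold rhoD eIn
    simp only [Finset.card_filter, ← Finset.sum_add_distrib]
    refine Finset.sum_congr rfl fun e _ => ?_
    by_cases h1 : hd e ∈ X <;> by_cases h2 : tl e ∈ X <;>
      rcases hor e with h | h <;> simp [h, h1, h2]
  omega

lemma mdeg_eq [Fintype V] [DecidableEq V] (ends : E → V × V) (tl hd : E → V)
    (hor : ∀ e, ends e = (tl e, hd e) ∨ ends e = (hd e, tl e)) (S : Finset E) (v : V) :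
    mdeg ends S v = cntAt tl S v + cntAt hd S v := by
  unfold mdeg cntAt
  simp only [Finset.card_filter, ← Finset.sum_add_distrib]
  refine Finset.sum_congr rfl fun e _ => ?_
  rcases hor e with h | h <;> simp [h]
  omega

lemma rho_submod [DecidableEq V] (tl hd : E → V) (S : Finset E) (X Y : Finset V) :
    rhoD tl hd S (X ∪ Y) + rhoD tl hd S (X ∩ Y) ≤ rhoD tl hd S X + rhoD tl hd S Y := by
  unfold rhoD
  simp only [Finset.card_filter, ← Finset.sum_add_distrib]
  refine Finset.sum_le_sum fun e _ => ?_
  by_cases h1 : hd e ∈ X <;> by_cases h2 : tl e ∈ X <;>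
  by_cases h3 : hd e ∈ Y <;> by_cases h4 : tl e ∈ Y <;> simp [h1, h2, h3, h4]

/-- `T` is an out-arborescence from `r`: reachability and in-degrees. -/
def IsArb [DecidableEq V] (tl hd : E → V) (r : V) (T : Finset E) : Prop :=
  (∀ v, Relation.ReflTransGen (fun a b => ∃ e ∈ T, tl e = a ∧ hd e = b) r v) ∧
  cntAt hd T r = 0 ∧ ∀ v, v ≠ r → cntAt hd T v = 1

/-- Edmonds' branching theorem, one step. -/
lemma exists_arb [Fintype V] [DecidableEq V] [DecidableEq E]
    (tl hd : E → V) (r : V) (k : ℕ) (D : Finset E)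
    (hD : ∀ X : Finset V, X.Nonempty → r ∉ X → k + 1 ≤ rhoD tl hd D X) :
    ∃ T ⊆ D, IsArb tl hd r T ∧
      ∀ X : Finset V, X.Nonempty → r ∉ X → k ≤ rhoD tl hd (D \ T) X := by
  classical
  let P : Finset V → Finset E → Prop := fun S T => r ∈ S ∧ T ⊆ D ∧
    (∀ e ∈ T, hd e ∈ S ∧ tl e ∈ S) ∧
    (∀ v ∈ S, Relation.ReflTransGen (fun a b => ∃ e ∈ T, tl e = a ∧ hd e = b) r v) ∧
    cntAt hd T r = 0 ∧ (∀ v ∈ S, v ≠ r → cntAt hd T v = 1) ∧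
    ∀ X : Finset V, X.Nonempty → r ∉ X → k ≤ rhoD tl hd (D \ T) X
  have step : ∀ S T, P S T → S ≠ Finset.univ → ∃ S' T', P S' T' ∧ S.card < S'.card := by
    rintro S T ⟨hrS, hTD, hTS, hreach, hr0, hin1, hrho⟩ hS
    let Q : Finset V → Prop := fun X => ¬ X ⊆ S ∧
      (X = Finset.univ ∨ (r ∉ X ∧ rhoD tl hd (D \ T) X = k))
    obtain ⟨X, hX, hXmin⟩ := Finset.exists_min_image
      ((Finset.univ : Finset (Finset V)).filter Q) Finset.card
      ⟨Finset.univ, by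
        simp only [Finset.mem_filter, Finset.mem_univ, true_and, Q, true_or, and_true]
        intro h; exact hS (Finset.univ_subset_iff.1 h)⟩
    simp only [Finset.mem_filter, Finset.mem_univ, true_and] at hX hXmin
    have hne : (X \ S).Nonempty := Finset.sdiff_nonempty.2 hX.1
    have h1 : k + 1 ≤ rhoD tl hd (D \ T) (X \ S) := by
      refine (hD (X \ S) hne (by simp [hrS])).trans (Finset.card_le_card ?_)
      intro e he
      simp only [Finset.mem_filter, Finset.mem_sdiff] at he ⊢
      refine ⟨⟨he.1, fun heT => he.2.1.2 (hTS e heT).1⟩, he.2⟩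
    have h2 : rhoD tl hd (D \ T) X ≤ k := by
      rcases hX.2 with h | h
      · subst h; simp [rhoD]
      · exact h.2.le
    have harc : ∃ e ∈ D \ T, hd e ∈ X \ S ∧ tl e ∈ X ∩ S := by
      by_contra hcon
      push Not at hcon
      have : rhoD tl hd (D \ T) (X \ S) ≤ rhoD tl hd (D \ T) X := by
        refine Finset.card_le_card fun e he => ?_
        rw [Finset.mem_filter] at he ⊢
        refine ⟨he.1, (Finset.mem_sdiff.1 he.2.1).1, fun htl => ?_⟩
        have h3 := hcon e he.1 he.2.1
        have h4 := he.2.2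
        simp only [Finset.mem_sdiff, Finset.mem_inter] at h3 h4
        tauto
      omega
    obtain ⟨e, heD, hhe, hte⟩ := harc
    rw [Finset.mem_sdiff] at heD hhe
    rw [Finset.mem_inter] at hte
    have hcnt : ∀ v, cntAt hd (insert e T) v = cntAt hd T v + if hd e = v then 1 else 0 := by
      intro v
      unfold cntAt
      simp only [Finset.card_filter]
      rw [Finset.sum_insert heD.2, add_comm]
    have hT0 : cntAt hd T (hd e) = 0 := by
      unfold cntAt
      rw [Finset.card_eq_zero, Finset.filter_eq_empty_iff]
      intro f hf h
      exact hhe.2 (h ▸ (hTS f hf).1)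
    have her : hd e ≠ r := fun h => hhe.2 (h ▸ hrS)
    have hmono : ∀ v, Relation.ReflTransGen (fun a b => ∃ e ∈ T, tl e = a ∧ hd e = b) r v →
        Relation.ReflTransGen (fun a b => ∃ f ∈ insert e T, tl f = a ∧ hd f = b) r v := by
      intro v hv
      refine Relation.ReflTransGen.mono ?_ _ _ hv
      rintro a b ⟨f, hf, h⟩
      exact ⟨f, Finset.mem_insert_of_mem hf, h⟩
    refine ⟨insert (hd e) S, insert e T, ⟨Finset.mem_insert_of_mem hrS, ?_, ?_, ?_, ?_, ?_, ?_⟩, ?_⟩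
    · exact Finset.insert_subset heD.1 hTD
    · intro f hf
      rcases Finset.mem_insert.1 hf with rfl | hf
      · exact ⟨Finset.mem_insert_self _ _, Finset.mem_insert_of_mem hte.2⟩
      · exact ⟨Finset.mem_insert_of_mem (hTS f hf).1, Finset.mem_insert_of_mem (hTS f hf).2⟩
    · intro v hv
      rcases Finset.mem_insert.1 hv with rfl | hv
      · exact (hmono _ (hreach _ hte.2)).tail ⟨e, Finset.mem_insert_self _ _, rfl, rfl⟩
      · exact hmono _ (hreach v hv)
    · rw [hcnt, hr0, if_neg her]
    · intro v hv hvr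
      rw [hcnt]
      rcases Finset.mem_insert.1 hv with rfl | hv
      · simp [hT0]
      · rw [hin1 v hv hvr, if_neg]
        rintro rfl; exact hhe.2 hv
    · intro Y hY hrY
      have hk := hrho Y hY hrY
      have hle : rhoD tl hd (D \ T) Y ≤
          rhoD tl hd (D \ insert e T) Y + if (hd e ∈ Y ∧ tl e ∉ Y) then 1 else 0 := by
        have : D \ T = insert e (D \ insert e T) := by
          ext f
          simp only [Finset.mem_sdiff, Finset.mem_insert]
          by_cases h : f = e
          · subst h; simp [heD]
          · simp [h]
        rw [this]
        unfold rhoD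
        simp only [Finset.card_filter]
        rw [Finset.sum_insert (by simp), add_comm]
      by_cases hent : hd e ∈ Y ∧ tl e ∉ Y
      · rw [if_pos hent] at hle
        by_contra hlt
        push Not at hlt
        have hYt : rhoD tl hd (D \ T) Y = k := by omega
        have hQ : Q (X ∩ Y) := by
          refine ⟨fun h => hhe.2 (h (Finset.mem_inter.2 ⟨hhe.1, hent.1⟩)), ?_⟩
          right
          refine ⟨by simp [hrY], ?_⟩
          rcases hX.2 with h | h
          · subst h; simpa using hYt
          · have h5 := rho_submod tl hd (D \ T) X Y
            have h6 := hrho (X ∪ Y) ⟨hd e, by simp [hhe.1]⟩ (by simp [h.1, hrY])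
            have h7 := hrho (X ∩ Y) ⟨hd e, by simp [hhe.1, hent.1]⟩ (by simp [hrY])
            have h8 := h.2
            omega
        have h9 := hXmin _ hQ
        have h10 := Finset.eq_of_subset_of_card_le Finset.inter_subset_left h9
        have : tl e ∈ X ∩ Y := by rw [h10]; exact hte.1
        exact hent.2 (Finset.mem_inter.1 this).2
      · rw [if_neg hent] at hle
        omega
    · rw [Finset.card_insert_of_notMem hhe.2]; omega
  have hfin : ∀ n, ∀ S T, P S T → Fintype.card V - S.card ≤ n → ∃ T, P Finset.univ T := by
    intro n
    induction n with
    | zero =>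
      intro S T h hn
      have : S = Finset.univ := by
        apply Finset.eq_univ_of_card
        have := Finset.card_le_univ S
        omega
      exact ⟨T, this ▸ h⟩
    | succ n ih =>
      intro S T h hn
      by_cases hS : S = Finset.univ
      · exact ⟨T, hS ▸ h⟩
      · obtain ⟨S', T', h', hlt⟩ := step S T h hS
        exact ih S' T' h' (by omega)
  have hbase : P {r} ∅ := by
    refine ⟨by simp, by simp, by simp, ?_, by simp [cntAt], ?_, ?_⟩
    · intro v hv
      rw [Finset.mem_singleton.1 hv]
    · intro v hv hne
      exact absurd (Finset.mem_singleton.1 hv) hne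
    · intro X hX hr
      have := hD X hX hr
      simp only [Finset.sdiff_empty]
      omega
  obtain ⟨T, h⟩ := hfin _ _ _ hbase le_rfl
  exact ⟨T, h.2.1, ⟨fun v => h.2.2.2.1 v (Finset.mem_univ v), h.2.2.2.2.1,
    fun v => h.2.2.2.2.2.1 v (Finset.mem_univ v)⟩, h.2.2.2.2.2.2⟩

lemma merge_cycles {α : Type*} [Fintype α] [DecidableEq α] (π : Equiv.Perm α) (e f : α)
    (hne : ¬ π.SameCycle e f) :
    ∀ x, π.SameCycle e x → (π * Equiv.swap e f).SameCycle f x := by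
  set π' := π * Equiv.swap e f with hπ'
  have h1 : π' e = π f := by simp [hπ']
  have h2 : π' f = π e := by simp [hπ']
  have h3 : ∀ x, x ≠ e → x ≠ f → π' x = π x := by
    intro x hx hx'
    simp [hπ', Equiv.swap_apply_of_ne_of_ne hx hx']
  have hfe : π'.SameCycle f e := by
    by_contra hcon
    have hk : ∀ k : ℕ, π'.SameCycle f ((π ^ (k + 1)) e) := by
      intro k
      induction k with
      | zero =>
        have := (Equiv.Perm.sameCycle_apply_right (f := π') (x := f) (y := f)).2
          (Equiv.Perm.SameCycle.refl _ _)
        rw [h2] at this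
        simpa using this
      | succ k ih =>
        set y := (π ^ (k + 1)) e with hy
        have hye : y ≠ e := by
          intro h; rw [h] at ih; exact hcon ih
        have hyf : y ≠ f := by
          intro h
          apply hne
          rw [← h, hy]
          exact Equiv.Perm.sameCycle_pow_right.2 (Equiv.Perm.SameCycle.refl _ _)
        have : (π ^ (k + 1 + 1)) e = π' y := by
          rw [h3 y hye hyf, hy, pow_succ' π (k + 1), Equiv.Perm.mul_apply]
        rw [this]
        exact Equiv.Perm.sameCycle_apply_right.2 ih
    have hpos : 0 < orderOf π := orderOf_pos π
    have := hk (orderOf π - 1)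
    rw [Nat.sub_add_cancel hpos, pow_orderOf_eq_one] at this
    exact hcon (by simpa using this)
  intro x hx
  obtain ⟨n, hn⟩ := hx.exists_nat_pow_eq
  have hk : ∀ k : ℕ, π'.SameCycle f ((π ^ k) e) := by
    intro k
    induction k with
    | zero => simpa using hfe
    | succ k ih =>
      rw [pow_succ', Equiv.Perm.mul_apply]
      set y := (π ^ k) e
      by_cases hye : y = e
      · rw [hye, ← h2]
        exact Equiv.Perm.sameCycle_apply_right.2 (Equiv.Perm.SameCycle.refl _ _)
      by_cases hyf : y = f
      · rw [hyf, ← h1]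
        exact Equiv.Perm.sameCycle_apply_right.2 hfe
      rw [← h3 y hye hyf]
      exact Equiv.Perm.sameCycle_apply_right.2 ih
  rw [← hn]
  exact hk n

lemma euler_perm {α : Type*} [Fintype α] [DecidableEq α] [DecidableEq V] (tl hd : α → V) (r : V)
    (hcnt : ∀ v, Fintype.card {a // hd a = v} = Fintype.card {a // tl a = v})
    (hreach : ∀ a, Relation.ReflTransGen (fun u v => ∃ e, tl e = u ∧ hd e = v) r (tl a)) :
    ∃ π : Equiv.Perm α, (∀ a, tl (π a) = hd a) ∧ ∀ a b, π.SameCycle a b := by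
  classical
  have hex : ∃ π : Equiv.Perm α, ∀ a, tl (π a) = hd a :=
    ⟨Equiv.ofFiberEquiv (f := hd) (g := tl) fun v => Fintype.equivOfCardEq (hcnt v),
      fun a => Equiv.ofFiberEquiv_map _ a⟩
  obtain ⟨π0, hπ0⟩ := hex
  rcases isEmpty_or_nonempty α with hα | ⟨⟨e0⟩⟩
  · exact ⟨π0, hπ0, fun a => (hα.false a).elim⟩
  obtain ⟨π, hπ, hmax⟩ := Finset.exists_max_image
    ((Finset.univ : Finset (Equiv.Perm α)).filter fun π => ∀ a, tl (π a) = hd a)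
    (fun π => (Finset.univ.filter fun x => π.SameCycle e0 x).card) ⟨π0, by simp [hπ0]⟩
  simp only [Finset.mem_filter, Finset.mem_univ, true_and] at hπ hmax
  have hshare : ∀ e f, π.SameCycle e0 e → hd e = hd f → π.SameCycle e0 f := by
    intro e f he hef
    by_contra hf
    have hne : ¬ π.SameCycle e f := fun h => hf (he.trans h)
    have hm := merge_cycles π e f hne
    have h1 := hmax (π * Equiv.swap e f) (by
      intro a
      rw [Equiv.Perm.mul_apply, hπ]
      by_cases ha : a = e
      · subst ha; simp [hef]
      by_cases hb : a = f
      · subst hb; simp [hef]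
      rw [Equiv.swap_apply_of_ne_of_ne ha hb])
    have h2 : (Finset.univ.filter fun x => π.SameCycle e0 x) ⊂
        (Finset.univ.filter fun x => (π * Equiv.swap e f).SameCycle e0 x) := by
      refine Finset.ssubset_iff_subset_ne.2 ⟨fun x hx => ?_, fun heq => ?_⟩
      · simp only [Finset.mem_filter, Finset.mem_univ, true_and] at hx ⊢
        exact (hm e0 he.symm).symm.trans (hm x (he.symm.trans hx))
      · have : f ∈ (Finset.univ.filter fun x => π.SameCycle e0 x) := by
          rw [heq]
          simp only [Finset.mem_filter, Finset.mem_univ, true_and]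
          exact (hm e0 he.symm).symm
        simp only [Finset.mem_filter, Finset.mem_univ, true_and] at this
        exact hf this
    have h3 := Finset.card_lt_card h2
    omega
  let U : V → Prop := fun v => ∃ e, π.SameCycle e0 e ∧ hd e = v
  have hUhd : ∀ f, U (hd f) → π.SameCycle e0 f := by
    rintro f ⟨e, he, hef⟩
    exact hshare e f he hef
  have hUtl : ∀ f, U (tl f) → π.SameCycle e0 f := by
    intro f hf
    have h1 : hd (π.symm f) = tl f := by rw [← hπ, Equiv.apply_symm_apply]
    rw [← h1] at hf
    have h2 := hUhd _ hf
    have h3 := Equiv.Perm.sameCycle_apply_right.2 h2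
    rwa [Equiv.apply_symm_apply] at h3
  have htlU : ∀ f, π.SameCycle e0 f → U (tl f) := by
    intro f hf
    refine ⟨π.symm f, ?_, by rw [← hπ, Equiv.apply_symm_apply]⟩
    apply Equiv.Perm.sameCycle_apply_right.1
    rwa [Equiv.apply_symm_apply]
  have hiff : ∀ v, Relation.ReflTransGen (fun u v => ∃ e, tl e = u ∧ hd e = v) r v →
      (U r ↔ U v) := by
    intro v hv
    induction hv with
    | refl => rfl
    | tail _ h ih =>
      obtain ⟨f, rfl, rfl⟩ := h
      rw [ih]
      exact ⟨fun h => ⟨f, hUtl f h, rfl⟩, fun h => htlU f (hUhd f h)⟩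
  have hr : U r := (hiff _ (hreach e0)).2 (htlU e0 (Equiv.Perm.SameCycle.refl _ _))
  have hall : ∀ f, π.SameCycle e0 f := fun f => hUtl f ((hiff _ (hreach f)).1 hr)
  exact ⟨π, hπ, fun a b => (hall a).symm.trans (hall b)⟩

lemma cycle_color {α : Type*} [Fintype α] [DecidableEq α] (π : Equiv.Perm α)
    (hπ : ∀ a b, π.SameCycle a b) (t : α → ZMod 2) (ht : ∑ a, t a = 0) :
    ∃ c : α → ZMod 2, ∀ a, c (π a) = c a + t a := by
  classical
  rcases isEmpty_or_nonempty α with hα | ⟨⟨e0⟩⟩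
  · exact ⟨fun _ => 0, fun a => (hα.false a).elim⟩
  have hcyc : π.IsCycleOn ((Finset.univ : Finset α) : Set α) := by
    refine ⟨?_, fun a _ b _ => hπ a b⟩
    simp [Set.bijOn_univ, π.bijective]
  have hk : ∀ x, ∃ n < (Finset.univ : Finset α).card, (π ^ n) e0 = x := fun x =>
    hcyc.exists_pow_eq (Finset.mem_univ e0) (Finset.mem_univ x)
  choose k hkN hk using hk
  set N := (Finset.univ : Finset α).card with hN
  have hsum : ∑ j ∈ Finset.range N, t ((π ^ j) e0) = 0 := by
    rw [← ht]
    refine Finset.sum_bij (fun j _ => (π ^ j) e0) (fun _ _ => Finset.mem_univ _) ?_ ?_ ?_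
    · intro i hi j hj hij
      have := (hcyc.pow_apply_eq_pow_apply (Finset.mem_univ e0)).1 hij
      exact Nat.ModEq.eq_of_lt_of_lt this (Finset.mem_range.1 hi) (Finset.mem_range.1 hj)
    · intro b _
      exact ⟨k b, Finset.mem_range.2 (hkN b), hk b⟩
    · intros; rfl
  refine ⟨fun x => ∑ j ∈ Finset.range (k x), t ((π ^ j) e0), fun x => ?_⟩
  have h1 : (π ^ (k x + 1)) e0 = (π ^ (k (π x))) e0 := by
    rw [hk, pow_succ', Equiv.Perm.mul_apply, hk]
  have h2 := (hcyc.pow_apply_eq_pow_apply (Finset.mem_univ e0)).1 h1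
  rw [← hN] at h2
  have h3 : ∑ j ∈ Finset.range (k x), t ((π ^ j) e0) + t x =
      ∑ j ∈ Finset.range (k x + 1), t ((π ^ j) e0) := by
    rw [Finset.sum_range_succ, hk]
  simp only
  rw [h3]
  have h4 := hkN x
  by_cases h5 : k x + 1 < N
  · rw [Nat.ModEq.eq_of_lt_of_lt h2 h5 (hkN _)]
  · have h6 : k x + 1 = N := by omega
    have h7 : k (π x) = 0 := by
      rw [h6] at h2
      have : k (π x) ≡ 0 [MOD N] := h2.symm.trans (by simp [Nat.ModEq])
      exact Nat.ModEq.eq_of_lt_of_lt this (hkN _) (by omega)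
    rw [h7, h6, hsum]; simp

lemma cntAt_erase [DecidableEq V] [DecidableEq E] (f : E → V) (S : Finset E) (e : E) (he : e ∈ S)
    (v : V) : cntAt f S v = cntAt f (S.erase e) v + if f e = v then 1 else 0 := by
  unfold cntAt
  simp only [Finset.card_filter]
  rw [add_comm, Finset.add_sum_erase S (fun e => if f e = v then 1 else 0) he]

lemma cntAt_insert [DecidableEq V] [DecidableEq E] (f : E → V) (S : Finset E) (e : E) (he : e ∉ S)
    (v : V) : cntAt f (insert e S) v = cntAt f S v + if f e = v then 1 else 0 := by
  unfold cntAt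
  simp only [Finset.card_filter]
  rw [add_comm, Finset.sum_insert he]

lemma cntAt_pos [DecidableEq V] {f : E → V} {S : Finset E} {v : V} :
    0 < cntAt f S v ↔ ∃ e ∈ S, f e = v := by
  unfold cntAt
  rw [Finset.card_pos]
  constructor
  · rintro ⟨e, he⟩; exact ⟨e, by simpa using he⟩
  · rintro ⟨e, he⟩; exact ⟨e, by simpa using he⟩

lemma cntAt_coe [DecidableEq V] (f : E → V) (S : Finset E) (v : V) :
    Fintype.card {a : S // f a = v} = cntAt f S v := by
  rw [Fintype.card_subtype]
  unfold cntAt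
  simp only [Finset.card_filter]
  exact Finset.sum_coe_sort S (fun e => if f e = v then 1 else 0)

/-- The Eulerian case. -/
lemma euler_factor [Fintype V] [DecidableEq V] [DecidableEq E] (tl hd : E → V) (r : V)
    (M : Finset E) (a b : V → ℤ)
    (hreach : ∀ e ∈ M, Relation.ReflTransGen (fun u v => ∃ e ∈ M, tl e = u ∧ hd e = v) r (tl e))
    (hbal : ∀ v, cntAt hd M v = cntAt tl M v)
    (hpar : ∀ v, Even (b v - a v))
    (ha : ∀ v, a v ≤ cntAt hd M v) (hb : ∀ v, (cntAt hd M v : ℤ) ≤ b v)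
    (hbig : ∀ v, 2 ≤ cntAt hd M v → a v = cntAt hd M v)
    (hzero : ∀ v, cntAt hd M v = 0 → Even (a v))
    (hsum : Even (∑ v, a v)) :
    ∃ X ⊆ M, ∀ v, a v ≤ (cntAt tl X v + cntAt hd X v : ℕ) ∧
      ((cntAt tl X v + cntAt hd X v : ℕ) : ℤ) ≤ b v ∧
      Even (((cntAt tl X v + cntAt hd X v : ℕ) : ℤ) - a v) := by
  classical
  obtain ⟨π, hπ, hcyc⟩ := euler_perm (fun x : M => tl x) (fun x : M => hd x) r
    (fun v => by rw [cntAt_coe, cntAt_coe, hbal]) (by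
      rintro ⟨e, he⟩
      refine Relation.ReflTransGen.mono ?_ _ _ (hreach e he)
      rintro u v ⟨f, hf, h⟩
      exact ⟨⟨f, hf⟩, h⟩)
  let t' : V → ZMod 2 := fun v => if cntAt hd M v = 1 then (a v : ZMod 2) else 1
  have hcard : ∀ v, (Finset.univ.filter fun x : M => hd x = v).card = cntAt hd M v := by
    intro v
    rw [← cntAt_coe, Fintype.card_subtype]
  have ht' : ∀ v, (cntAt hd M v) • t' v = (a v : ZMod 2) := by
    intro v
    by_cases h1 : cntAt hd M v = 1
    · simp [t', h1]
    · simp only [t', if_neg h1]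
      by_cases h0 : cntAt hd M v = 0
      · have := hzero v h0
        rw [h0, zero_smul]
        exact ((ZMod.intCast_zmod_eq_zero_iff_dvd (a v) 2).2 (by exact_mod_cast this.two_dvd)).symm
      · rw [hbig v (by omega)]
        simp
  obtain ⟨c, hc⟩ := cycle_color π hcyc (fun x => t' (hd x)) (by
    rw [← Finset.sum_fiberwise (s := Finset.univ) (g := fun x : M => hd x)]
    have : ∀ v ∈ (Finset.univ : Finset V),
        (∑ x ∈ Finset.univ.filter (fun x : M => hd x = v), t' (hd x)) = (a v : ZMod 2) := by
      intro v _
      rw [← ht' v, ← hcard, ← Finset.sum_const]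
      refine Finset.sum_congr rfl fun x hx => ?_
      rw [(Finset.mem_filter.1 hx).2]
    rw [Finset.sum_congr rfl this]
    rw [← Int.cast_sum]
    exact (ZMod.intCast_zmod_eq_zero_iff_dvd _ 2).2 (by exact_mod_cast hsum.two_dvd))
  let X : Finset E := M.filter fun e => ∃ h : e ∈ M, c ⟨e, h⟩ = 1
  have hX : ∀ (f : E → V) v, cntAt f X v = ∑ x : M, if f x = v ∧ c x = 1 then 1 else 0 := by
    intro f v
    unfold cntAt
    simp only [X]
    rw [Finset.filter_filter, Finset.card_filter, ← Finset.sum_coe_sort]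
    refine Finset.sum_congr rfl fun x _ => ?_
    have : (∃ h : (x : E) ∈ M, c ⟨x, h⟩ = 1) ↔ c x = 1 :=
      ⟨fun ⟨_, h⟩ => h, fun h => ⟨x.2, h⟩⟩
    simp only [this, and_comm]
  have hdeg : ∀ v, cntAt tl X v + cntAt hd X v =
      ∑ x ∈ Finset.univ.filter (fun x : M => hd x = v),
        ((if c (π x) = 1 then 1 else 0) + (if c x = 1 then 1 else 0)) := by
    intro v
    rw [hX, hX, ← Equiv.sum_comp π, ← Finset.sum_add_distrib, Finset.sum_filter]
    refine Finset.sum_congr rfl fun x _ => ?_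
    have := hπ x
    rw [this]
    by_cases h : hd x = v <;> simp [h]
  have hz : ∀ z : ZMod 2, z = 0 ∨ z = 1 := by decide
  refine ⟨X, Finset.filter_subset _ _, fun v => ?_⟩
  rw [hdeg]
  have hav := ha v
  have hbv := hb v
  obtain ⟨q, hq⟩ := hpar v
  by_cases h1 : cntAt hd M v = 1
  · have h2 := hcard v
    rw [h1, Finset.card_eq_one] at h2
    obtain ⟨x, hx⟩ := h2
    have hxv : hd x = v := by
      have : x ∈ Finset.univ.filter (fun x : M => hd x = v) := by rw [hx]; simp
      simpa using this
    rw [hx, Finset.sum_singleton]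
    have h3 := hc x
    simp only [hxv, t', if_pos h1] at h3
    rw [h1] at hav hbv
    rcases Int.even_or_odd' (a v) with ⟨j, hj | hj⟩
    · have h4 : (a v : ZMod 2) = 0 := (ZMod.intCast_zmod_eq_zero_iff_dvd _ 2).2 ⟨j, by exact_mod_cast hj⟩
      rw [h4, add_zero] at h3
      rw [h3]
      rcases hz (c x) with h5 | h5 <;> simp only [h5]
      · refine ⟨?_, ?_, ?_⟩ <;> simp <;> try omega
        rw [hj]; simp
      · refine ⟨?_, ?_, ?_⟩ <;> simp <;> try omega
        rw [hj]; exact ⟨1 - j, by ring⟩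
    · have h4 : (a v : ZMod 2) = 1 := by
        rw [hj]; push_cast
        have : (2 : ZMod 2) = 0 := by decide
        rw [this]; ring
      rw [h4] at h3
      rw [h3]
      have h6 : (1 + 1 : ZMod 2) = 0 := by decide
      rcases hz (c x) with h5 | h5 <;> simp only [h5, h6]
      · refine ⟨?_, ?_, ?_⟩ <;> simp <;> try omega
        rw [hj]; exact ⟨- j, by ring⟩
      · refine ⟨?_, ?_, ?_⟩ <;> simp <;> try omega
        rw [hj]; exact ⟨- j, by ring⟩
  · have h2 : ∑ x ∈ Finset.univ.filter (fun x : M => hd x = v),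
        ((if c (π x) = 1 then 1 else 0) + (if c x = 1 then 1 else 0)) = cntAt hd M v := by
      rw [← hcard, Finset.card_eq_sum_ones]
      refine Finset.sum_congr rfl fun x hx => ?_
      have h3 := hc x
      have hxv : hd x = v := (Finset.mem_filter.1 hx).2
      simp only [hxv, t', if_neg h1] at h3
      rw [h3]
      have h6 : (1 + 1 : ZMod 2) = 0 := by decide
      rcases hz (c x) with h5 | h5 <;> simp [h5, h6]
    rw [h2]
    refine ⟨hav, hbv, ?_⟩
    by_cases h0 : cntAt hd M v = 0
    · have := hzero v h0
      rw [h0]; simpa using this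
    · rw [hbig v (by omega)]; simp

/-- Parity factors in rooted digraphs. -/
lemma parity_factor [Fintype V] [DecidableEq V] [DecidableEq E] (tl hd : E → V) (r : V) :
    ∀ (n : ℕ) (M T : Finset E) (a b : V → ℤ), M.card = n → T ⊆ M →
    (∀ v, (0 < cntAt hd M v ∨ 0 < cntAt tl M v) →
      Relation.ReflTransGen (fun u v => ∃ e ∈ T, tl e = u ∧ hd e = v) r v) →
    (∀ v, cntAt hd T v ≤ 1) →
    (∀ v, Even (b v - a v)) → (∀ v, a v ≤ b v) →
    (∀ v, a v ≤ cntAt hd M v) → (∀ v, (cntAt tl M v : ℤ) ≤ b v) →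
    (∀ v, v ≠ r → cntAt hd M v = 0 → Even (a v)) →
    Even (∑ v, a v) →
    ∃ X ⊆ M, ∀ v, a v ≤ (cntAt tl X v + cntAt hd X v : ℕ) ∧
      ((cntAt tl X v + cntAt hd X v : ℕ) : ℤ) ≤ b v ∧
      Even (((cntAt tl X v + cntAt hd X v : ℕ) : ℤ) - a v) := by
  classical
  intro n
  induction n with
  | zero =>
    intro M T a b hn hTM hreach hT1 hpar hab ha hb hzero hsum
    have hM : M = ∅ := Finset.card_eq_zero.1 hn
    subst hM
    have hev : ∀ v, v ≠ r → Even (a v) := fun v hv => hzero v hv (by simp [cntAt])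
    have hr : Even (a r) := by
      rw [← Finset.add_sum_erase _ _ (Finset.mem_univ r)] at hsum
      have h2 : Even (∑ v ∈ Finset.univ.erase r, a v) := by
        rw [even_iff_two_dvd]
        exact Finset.dvd_sum fun v hv => (hev v (Finset.ne_of_mem_erase hv)).two_dvd
      exact (Int.even_add.1 hsum).2 h2
    refine ⟨∅, Finset.Subset.refl _, fun v => ?_⟩
    have h1 := ha v
    have h2 := hb v
    have h3 : Even (a v) := by
      by_cases h : v = r
      · exact h ▸ hr
      · exact hev v h
    simp only [cntAt, Finset.filter_empty, Finset.card_empty] at h1 h2 ⊢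
    exact ⟨by simpa using h1, by simpa using h2, by simpa using h3⟩
  | succ n ih =>
    intro M T a b hn hTM hreach hT1 hpar hab ha hb hzero hsum
    -- a reachable non-root vertex has an in-arc in `T`
    have hinT : ∀ v, v ≠ r → (0 < cntAt hd M v ∨ 0 < cntAt tl M v) → 0 < cntAt hd T v := by
      intro v hv h
      rcases Relation.ReflTransGen.cases_tail (hreach v h) with h1 | ⟨u, _, e, he, _, h3⟩
      · exact absurd h1 hv
      · exact cntAt_pos.2 ⟨e, he, h3⟩
    have hTMle : ∀ v, cntAt hd T v ≤ cntAt hd M v := fun v =>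
      Finset.card_le_card (Finset.filter_subset_filter _ hTM)
    -- generic removal of an arc
    have remove : ∀ (e : E) (x : ℤ) (T' : Finset E), e ∈ M → (x = 0 ∨ x = 1) →
        T' ⊆ M.erase e → T' ⊆ T →
        (∀ v, (0 < cntAt hd (M.erase e) v ∨ 0 < cntAt tl (M.erase e) v) →
          Relation.ReflTransGen (fun u v => ∃ e ∈ T', tl e = u ∧ hd e = v) r v) →
        a (hd e) - x ≤ cntAt hd M (hd e) - 1 →
        (cntAt tl M (hd e) : ℤ) ≤ b (hd e) - x →
        (hd e ≠ r → cntAt hd M (hd e) = 1 → tl e ≠ hd e ∧ Even (a (hd e) - x)) →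
        ∃ X ⊆ M, ∀ v, a v ≤ (cntAt tl X v + cntAt hd X v : ℕ) ∧
          ((cntAt tl X v + cntAt hd X v : ℕ) : ℤ) ≤ b v ∧
          Even (((cntAt tl X v + cntAt hd X v : ℕ) : ℤ) - a v) := by
      intro e x T' he hx hT'M hT'T hreach' haw hbw hzw
      let s : V → ℤ := fun v => x * ((if tl e = v then 1 else 0) + (if hd e = v then 1 else 0))
      have hin := fun v => cntAt_erase hd M e he v
      have hout := fun v => cntAt_erase tl M e he v
      obtain ⟨X, hXM, hX⟩ := ih (M.erase e) T' (fun v => a v - s v) (fun v => b v - s v)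
        (by rw [Finset.card_erase_of_mem he]; omega) hT'M hreach'
        (fun v => (Finset.card_le_card (Finset.filter_subset_filter _ hT'T)).trans (hT1 v))
        (fun v => by simpa using hpar v) (fun v => by simpa using hab v)
        (by
          intro v
          have h1 := hin v
          have h2 := ha v
          have h3 := hTMle v
          change a v - x * ((if tl e = v then 1 else 0) + (if hd e = v then 1 else 0)) ≤ _
          by_cases hv : hd e = v
          · subst hv
            by_cases hu : tl e = hd e
            · simp only [hu, if_true] at h1 ⊢
              rcases hx with rfl | rfl <;> omega
            · simp only [hu, if_true, if_false] at h1 ⊢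
              rcases hx with rfl | rfl <;> omega
          · by_cases hu : tl e = v
            · simp only [hv, hu, if_true, if_false] at h1 ⊢
              rcases hx with rfl | rfl <;> omega
            · simp only [hv, hu, if_false] at h1 ⊢
              rcases hx with rfl | rfl <;> omega)
        (by
          intro v
          have h1 := hout v
          have h2 := hb v
          change _ ≤ b v - x * ((if tl e = v then 1 else 0) + (if hd e = v then 1 else 0))
          by_cases hv : hd e = v
          · subst hv
            by_cases hu : tl e = hd e
            · simp only [hu, if_true] at h1 ⊢
              rcases hx with rfl | rfl <;> omega
            · simp only [hu, if_true, if_false] at h1 ⊢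
              rcases hx with rfl | rfl <;> omega
          · by_cases hu : tl e = v
            · simp only [hv, hu, if_true, if_false] at h1 ⊢
              rcases hx with rfl | rfl <;> omega
            · simp only [hv, hu, if_false] at h1 ⊢
              rcases hx with rfl | rfl <;> omega)
        (by
          intro v hvr hv0
          have h1 := hin v
          rw [hv0] at h1
          by_cases hv : hd e = v
          · subst hv
            rw [if_pos rfl] at h1
            obtain ⟨h2, h3⟩ := hzw hvr h1
            simpa [s, h2] using h3
          · rw [if_neg hv] at h1
            have h2 : tl e ≠ v := by
              intro h2
              have h3 := hinT v hvr (Or.inr (cntAt_pos.2 ⟨e, he, h2⟩))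
              have h4 := hTMle v
              omega
            simpa [s, h2, hv] using hzero v hvr h1)
        (by
          have h1 : ∑ v, s v = x * 2 := by
            simp only [s]
            rw [← Finset.mul_sum, Finset.sum_add_distrib]
            simp
          rw [Finset.sum_sub_distrib, h1]
          exact hsum.sub (by simp))
      have heX : e ∉ X := fun h => Finset.notMem_erase e M (hXM h)
      rcases hx with rfl | rfl
      · refine ⟨X, hXM.trans (Finset.erase_subset _ _), fun v => ?_⟩
        simpa [s] using hX v
      · refine ⟨insert e X, Finset.insert_subset he (hXM.trans (Finset.erase_subset _ _)),
          fun v => ?_⟩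
        obtain ⟨h1, h2, h3⟩ := hX v
        rw [cntAt_insert tl X e heX, cntAt_insert hd X e heX]
        simp only [s, one_mul] at h1 h2 h3
        refine ⟨?_, ?_, ?_⟩
        · push_cast at h1 ⊢; linarith
        · push_cast at h2 ⊢; linarith
        · push_cast at h3 ⊢
          convert h3 using 1
          ring
    by_cases hF : ∃ e ∈ M, e ∉ T ∧ (a (hd e) < cntAt hd M (hd e) ∨ (cntAt tl M (hd e) : ℤ) < b (hd e))
    · obtain ⟨e, he, heT, hor⟩ := hF
      have hTe : T ⊆ M.erase e := fun f hf =>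
        Finset.mem_erase.2 ⟨fun h => heT (h ▸ hf), hTM hf⟩
      have hre : ∀ v, (0 < cntAt hd (M.erase e) v ∨ 0 < cntAt tl (M.erase e) v) →
          Relation.ReflTransGen (fun u v => ∃ e ∈ T, tl e = u ∧ hd e = v) r v := by
        intro v hv
        apply hreach
        rw [cntAt_erase hd M e he, cntAt_erase tl M e he]
        omega
      have hno : hd e ≠ r → cntAt hd M (hd e) = 1 → False := by
        intro h1 h2
        have h3 := hinT _ h1 (Or.inl (by omega))
        have h4 : cntAt hd T (hd e) ≤ cntAt hd (M.erase e) (hd e) :=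
          Finset.card_le_card (Finset.filter_subset_filter _ hTe)
        have h5 := cntAt_erase hd M e he (hd e)
        rw [if_pos rfl] at h5
        omega
      have haw := ha (hd e)
      have hbw := hb (hd e)
      rcases hor with h | h
      · exact remove e 0 T he (Or.inl rfl) hTe (Finset.Subset.refl _) hre (by omega) (by omega)
          fun h1 h2 => (hno h1 h2).elim
      · exact remove e 1 T he (Or.inr rfl) hTe (Finset.Subset.refl _) hre (by omega) (by omega)
          fun h1 h2 => (hno h1 h2).elim
    by_cases hL : ∃ w, cntAt hd M w = 1 ∧ cntAt tl M w = 0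
    · obtain ⟨w, hw1, hw0⟩ := hL
      obtain ⟨e, he, rfl⟩ := cntAt_pos.1 (show 0 < cntAt hd M w by omega)
      have hout : ∀ f ∈ M, tl f ≠ hd e := by
        intro f hf h
        have := cntAt_pos.2 ⟨f, hf, h⟩
        omega
      have hpath : ∀ v, Relation.ReflTransGen (fun u v => ∃ e ∈ T, tl e = u ∧ hd e = v) r v →
          v ≠ hd e →
          Relation.ReflTransGen (fun u v => ∃ f ∈ T.erase e, tl f = u ∧ hd f = v) r v := by
        intro v hv
        induction hv with
        | refl => intro _; exact Relation.ReflTransGen.refl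
        | tail _ h ih2 =>
          obtain ⟨f, hf, rfl, rfl⟩ := h
          intro hne
          refine (ih2 (hout f (hTM hf))).tail ⟨f, Finset.mem_erase.2 ⟨?_, hf⟩, rfl, rfl⟩
          rintro rfl; exact hne rfl
      have hre : ∀ v, (0 < cntAt hd (M.erase e) v ∨ 0 < cntAt tl (M.erase e) v) →
          Relation.ReflTransGen (fun u v => ∃ f ∈ T.erase e, tl f = u ∧ hd f = v) r v := by
        intro v hv
        have h1 := cntAt_erase hd M e he v
        have h2 := cntAt_erase tl M e he v
        refine hpath v (hreach v (by omega)) ?_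
        rintro rfl
        rw [if_pos rfl] at h1
        omega
      have haw := ha (hd e)
      have hbw := hb (hd e)
      have hp := hpar (hd e)
      rw [hw1] at haw
      rw [hw0] at hbw
      have hsub : T.erase e ⊆ M.erase e := Finset.erase_subset_erase _ hTM
      rcases Int.even_or_odd (a (hd e)) with h | h
      · obtain ⟨j, hj⟩ := h
        exact remove e 0 _ he (Or.inl rfl) hsub (Finset.erase_subset _ _) hre
          (by rw [hw1]; push_cast at haw ⊢; omega) (by rw [hw0]; omega)
          fun _ _ => ⟨hout e he, ⟨j, by omega⟩⟩
      · obtain ⟨j, hj⟩ := h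
        obtain ⟨q, hq⟩ := hp
        exact remove e 1 _ he (Or.inr rfl) hsub (Finset.erase_subset _ _) hre
          (by rw [hw1]; push_cast at haw ⊢; omega) (by rw [hw0]; push_cast at hbw ⊢; omega)
          fun _ _ => ⟨hout e he, ⟨j, by omega⟩⟩
    -- stuck: Eulerian
    push Not at hF hL
    have hFv : ∀ v, cntAt hd T v < cntAt hd M v →
        a v = cntAt hd M v ∧ b v = cntAt tl M v := by
      intro v hv
      have : ∃ e ∈ M, e ∉ T ∧ hd e = v := by
        by_contra hcon
        push Not at hcon
        have : cntAt hd M v ≤ cntAt hd T v := by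
          refine Finset.card_le_card fun e he => ?_
          rw [Finset.mem_filter] at he ⊢
          refine ⟨?_, he.2⟩
          by_contra h
          exact hcon e he.1 h he.2
        omega
      obtain ⟨e, he, heT, rfl⟩ := this
      have h1 := hF e he heT
      have h2 := ha (hd e)
      have h3 := hb (hd e)
      exact ⟨by omega, by omega⟩
    have hle : ∀ v ∈ (Finset.univ : Finset V), cntAt hd M v ≤ cntAt tl M v := by
      intro v _
      by_cases h : cntAt hd T v < cntAt hd M v
      · obtain ⟨h1, h2⟩ := hFv v h
        have := hab v
        omega
      · have h1 := hT1 v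
        by_cases h0 : cntAt hd M v = 0
        · omega
        · have := hL v (by omega)
          omega
    have hbal : ∀ v, cntAt hd M v = cntAt tl M v := by
      have h1 : ∑ v, cntAt hd M v = ∑ v, cntAt tl M v := by
        rw [sum_cntAt, sum_cntAt]; simp
      intro v
      exact (Finset.sum_eq_sum_iff_of_le hle).1 h1 v (Finset.mem_univ v)
    refine euler_factor tl hd r M a b ?_ hbal hpar ha (fun v => hbal v ▸ hb v) ?_ ?_ hsum
    · intro e he
      refine Relation.ReflTransGen.mono ?_ _ _ (hreach (tl e) (Or.inr (cntAt_pos.2 ⟨e, he, rfl⟩)))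
      rintro u v ⟨f, hf, h⟩
      exact ⟨f, hTM hf, h⟩
    · intro v hv
      have := hT1 v
      exact (hFv v (by omega)).1
    · intro v hv
      by_cases hvr : v = r
      · subst hvr
        exfalso
        obtain ⟨e, he⟩ := Finset.card_pos.1 (show 0 < M.card by omega)
        have h0 : ¬ 0 < cntAt tl M v := by rw [← hbal]; omega
        apply h0
        rcases Relation.ReflTransGen.cases_head
          (hreach (tl e) (Or.inr (cntAt_pos.2 ⟨e, he, rfl⟩))) with h1 | ⟨u, ⟨f, hf, h2, _⟩, _⟩
        · exact cntAt_pos.2 ⟨e, he, h1.symm⟩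
        · exact cntAt_pos.2 ⟨f, hTM hf, h2⟩
      · exact hzero v hvr hv

/-- Every 4-edge-connected graph `G` has a spanning Eulerian subgraph `H`
(a connected spanning subgraph with all degrees even) such that for each vertex `v`,
`⌊d_G(v)/2⌋ - 1 ≤ d_H(v) ≤ ⌈d_G(v)/2⌉ + 2`. -/
theorem statement_0 [Fintype V] [DecidableEq V] [Fintype E] [DecidableEq E]
    (ends : E → V × V)
    (hG : EdgeConnected ends 4 (Finset.univ : Finset E)) :
    ∃ H : Finset E, MConnected ends H ∧ (∀ v, Even (mdeg ends H v)) ∧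
      ∀ v : V,
        ((mdeg ends (Finset.univ : Finset E) v / 2 : ℕ) : ℤ) - 1 ≤ (mdeg ends H v : ℤ) ∧
        (mdeg ends H v : ℤ) ≤
          (((mdeg ends (Finset.univ : Finset E) v + 1) / 2 : ℕ) : ℤ) + 2 := by
  classical
  rcases isEmpty_or_nonempty V with hV | ⟨⟨r⟩⟩
  · exact ⟨∅, fun u => (hV.false u).elim, fun u => (hV.false u).elim, fun u => (hV.false u).elim⟩
  obtain ⟨tl, hd, hor, hin, hrho⟩ := exists_orientation ends hG r
  obtain ⟨T1, -, ⟨hreach1, hr1, hv1⟩, hrho1⟩ := exists_arb tl hd r 1 Finset.univ hrho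
  set M : Finset E := Finset.univ \ T1 with hM
  obtain ⟨T2, hT2M, ⟨hreach2, hr2, hv2⟩, -⟩ := exists_arb tl hd r 0 M hrho1
  have hsplit : ∀ (f : E → V) v, cntAt f (Finset.univ : Finset E) v = cntAt f T1 v + cntAt f M v := by
    intro f v
    unfold cntAt
    simp only [Finset.card_filter, hM]
    rw [add_comm, Finset.sum_sdiff (Finset.subset_univ T1)]
  set d : V → ℕ := fun v => mdeg ends (Finset.univ : Finset E) v with hd_def
  have hdeg : ∀ v, d v = cntAt tl Finset.univ v + cntAt hd Finset.univ v :=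
    fun v => mdeg_eq ends tl hd hor _ v
  let L : V → ℤ := fun v => ((d v / 2 : ℕ) : ℤ) - 1
  let U : V → ℤ := fun v => (((d v + 1) / 2 : ℕ) : ℤ) + 2
  let t : V → ℤ := fun v => (cntAt tl T1 v : ℤ) + cntAt hd T1 v
  obtain ⟨X, hXM, hX⟩ := parity_factor tl hd r _ M T2
    (fun v => L v + L v % 2 - t v) (fun v => U v - U v % 2 - t v) rfl hT2M
    (fun v _ => hreach2 v)
    (fun v => by
      by_cases h : v = r
      · subst h; omega
      · exact (hv2 v h).le)
    (fun v => by rw [Int.even_iff]; omega)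
    (fun v => by simp only [L, U]; omega)
    (fun v => by
      have h1 := hin v
      have h2 := hsplit hd v
      have h3 := hsplit tl v
      simp only [L, t]
      change d v / 2 ≤ _ at h1
      by_cases h : v = r
      · subst h; omega
      · have := hv1 v h; omega)
    (fun v => by
      have h1 := hin v
      have h2 := hsplit hd v
      have h3 := hsplit tl v
      have h4 := hdeg v
      simp only [U, t]
      change d v / 2 ≤ _ at h1
      by_cases h : v = r
      · subst h; omega
      · have := hv1 v h; omega)
    (fun v hvr hv0 => by
      have h1 := hv2 v hvr
      have h2 : cntAt hd T2 v ≤ cntAt hd M v :=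
        Finset.card_le_card (Finset.filter_subset_filter _ hT2M)
      omega)
    (by
      rw [Finset.sum_sub_distrib]
      refine Even.sub ?_ ?_
      · rw [even_iff_two_dvd]
        exact Finset.dvd_sum fun v _ => by omega
      · simp only [t]
        rw [Finset.sum_add_distrib, ← Nat.cast_sum, ← Nat.cast_sum, sum_cntAt, sum_cntAt]
        simp)
  have hdisj : Disjoint T1 X :=
    Finset.disjoint_of_subset_right hXM (by rw [hM]; exact Finset.disjoint_sdiff)
  have hH : ∀ v, (mdeg ends (T1 ∪ X) v : ℤ) = t v + (cntAt tl X v + cntAt hd X v : ℕ) := by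
    intro v
    have : mdeg ends (T1 ∪ X) v = mdeg ends T1 v + mdeg ends X v := by
      unfold mdeg; rw [Finset.sum_union hdisj]
    rw [this, mdeg_eq ends tl hd hor, mdeg_eq ends tl hd hor]
    simp only [t]; push_cast; ring
  refine ⟨T1 ∪ X, ?_, ?_, ?_⟩
  · have h1 : ∀ v, Relation.ReflTransGen
        (fun a b => ∃ e ∈ T1 ∪ X, ends e = (a, b) ∨ ends e = (b, a)) r v := by
      intro v
      refine Relation.ReflTransGen.mono ?_ _ _ (hreach1 v)
      rintro a b ⟨e, he, rfl, rfl⟩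
      exact ⟨e, Finset.mem_union_left _ he, hor e⟩
    have h2 : ∀ v, Relation.ReflTransGen
        (fun a b => ∃ e ∈ T1 ∪ X, ends e = (a, b) ∨ ends e = (b, a)) v r := by
      intro v
      induction h1 v with
      | refl => exact Relation.ReflTransGen.refl
      | tail _ h ih =>
        obtain ⟨e, he, h⟩ := h
        exact Relation.ReflTransGen.head ⟨e, he, h.symm⟩ ih
    exact fun u v => (h2 u).trans (h1 v)
  · intro v
    obtain ⟨-, -, q, hq⟩ := hX v
    have := hH v
    rw [Nat.even_iff]
    omega
  · intro v
    obtain ⟨h1, h2, q, hq⟩ := hX v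
    have := hH v
    change L v ≤ _ ∧ _ ≤ U v
    omega
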